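/- Let G : (0,∞) → ℝ be continuous. Then for all real a, b with 0 < a ≤ b < 1, ∫_a^b G(f(-q^{1/5})/(q^{1/5}·f(-q^5))) · q^{-4/5} · f(-q)^5 / f(-q^{1/5}) dq = -5·∫_{y(a)}^{y(b)} G(x) / (x·√(5 + 2x + x²)) dx. -/

import Mathlib

open MeasureTheory Real

/-- Euler's product `f(-q) = ∏_{n=1}^∞ (1 - qⁿ)`. -/
noncomputable def eulerF (q : ℝ) : ℝ := ∏' n : ℕ, (1 - q ^ (n + 1))

/-- `y(q) = f(-q^{1/5}) / (q^{1/5} · f(-q⁵))`. -/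
noncomputable def yF (q : ℝ) : ℝ :=
  eulerF (q ^ ((1 : ℝ) / 5)) / (q ^ ((1 : ℝ) / 5) * eulerF (q ^ 5))

theorem summable_int_pow_mul_rpow_quadratic {q : ℝ} (hq : 0 < q) (hq1 : q < 1) {a : ℝ}
    (ha : 0 < a) (b c : ℝ) (k : ℕ) :
    Summable fun n : ℤ => (n : ℝ) ^ k * q ^ (a * (n : ℝ) ^ 2 + b * n + c) := by
  have hL : 0 < -log q := neg_pos.2 (log_neg hq hq1)
  have h := (summable_pow_mul_jacobiTheta₂_term_bound (-log q * |b| / (2 * π))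
    (T := -log q * a / π) (by positivity) k).mul_left (exp (log q * c))
  refine Summable.of_norm_bounded h fun n => ?_
  rw [norm_mul, norm_pow, norm_eq_abs, norm_eq_abs, abs_of_pos (rpow_pos_of_pos hq _),
    rpow_def_of_pos hq, mul_left_comm, ← Real.exp_add]
  push_cast
  gcongr
  have h1 : -(b * n) ≤ |b| * |(n : ℝ)| := by
    rw [← abs_mul]; exact neg_le_abs _
  have e : -π * (-log q * a / π * (n : ℝ) ^ 2 - 2 * (-log q * |b| / (2 * π)) * |(n : ℝ)|)
      = log q * a * (n : ℝ) ^ 2 + (-log q) * (|b| * |(n : ℝ)|) := by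
    field_simp
    ring
  rw [e]
  nlinarith

theorem summable_affine_pow_mul_rpow {q : ℝ} (hq : 0 < q) (hq1 : q < 1) {a : ℝ}
    (ha : 0 < a) (b c : ℝ) (s t : ℝ) (k : ℕ) :
    Summable fun n : ℤ => (s * n + t) ^ k * q ^ (a * (n : ℝ) ^ 2 + b * n + c) := by
  simp_rw [add_pow, Finset.sum_mul, mul_pow]
  refine summable_sum fun i _ => ?_
  refine ((summable_int_pow_mul_rpow_quadratic hq hq1 ha b c i).mul_left
    (s ^ i * t ^ (k - i) * (k.choose i))).congr fun n => ?_
  ring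

theorem norm_neg_one_zpow (n : ℤ) : ‖(-1 : ℝ) ^ n‖ = 1 := by
  rw [norm_zpow]; simp

theorem Summable.neg_one_zpow_mul {f : ℤ → ℝ} (hf : Summable f) :
    Summable fun n : ℤ => (-1 : ℝ) ^ n * f n := by
  refine Summable.of_norm_bounded hf.norm fun n => ?_
  rw [norm_mul, norm_neg_one_zpow, one_mul]

theorem tsum_eq_sum_tsum_of_bijective {ι α β : Type*} [Fintype ι] (φ : ι → α → β)
    (hφ : Function.Bijective fun x : ι × α => φ x.1 x.2) {F : β → ℝ} (hF : Summable F) :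
    ∑' b, F b = ∑ i, ∑' a, F (φ i a) := by
  have h : Summable fun x : ι × α => F (φ x.1 x.2) :=
    hF.comp_injective (i := fun x : ι × α => φ x.1 x.2) hφ.1
  rw [← (Equiv.ofBijective _ hφ).tsum_eq F]
  exact h.tsum_prod.trans (tsum_fintype _)

theorem tsum_eq_add_tsum_of_bijective {α β : Type*} (φ ψ : α → β)
    (h₁ : φ.Injective) (h₂ : ψ.Injective) (h₃ : ∀ a b, φ a ≠ ψ b)
    (h₄ : ∀ b, (∃ a, φ a = b) ∨ ∃ a, ψ a = b) {F : β → ℝ} (hF : Summable F) :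
    ∑' b, F b = ∑' a, F (φ a) + ∑' a, F (ψ a) := by
  have := tsum_eq_sum_tsum_of_bijective (fun i : Bool => cond i φ ψ)
    ⟨?_, ?_⟩ hF
  · simpa using this
  · rintro ⟨_ | _, a⟩ ⟨_ | _, b⟩ h <;> simp only [cond_true, cond_false] at h
    · rw [h₂ h]
    · exact (h₃ _ _ h.symm).elim
    · exact (h₃ _ _ h).elim
    · rw [h₁ h]
  · intro b
    rcases h₄ b with ⟨a, rfl⟩ | ⟨a, rfl⟩
    exacts [⟨(true, a), rfl⟩, ⟨(false, a), rfl⟩]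

/-- The theta series `∑ (-1)ⁿ q^{r (s n + t)²}` over all integers `n`. -/
noncomputable def altTheta (r s t q : ℝ) : ℝ := ∑' n : ℤ, (-1 : ℝ) ^ n * q ^ (r * (s * n + t) ^ 2)

/-- The `q d/dq` derivative of `altTheta`. -/
noncomputable def altThetaD (r s t q : ℝ) : ℝ :=
  ∑' n : ℤ, (-1 : ℝ) ^ n * (r * (s * n + t) ^ 2 * q ^ (r * (s * n + t) ^ 2))

theorem summable_affine_pow_mul_rpow_sq {q : ℝ} (hq : 0 < q) (hq1 : q < 1) {r s : ℝ}
    (hr : 0 < r) (hs : s ≠ 0) (t : ℝ) (k : ℕ) :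
    Summable fun n : ℤ => (s * n + t) ^ k * q ^ (r * (s * n + t) ^ 2) := by
  refine (summable_affine_pow_mul_rpow hq hq1 (a := r * s ^ 2) (by positivity)
    (2 * r * s * t) (r * t ^ 2) s t k).congr fun n => ?_
  congr 2
  ring

theorem hasDerivAt_altTheta {q : ℝ} (hq : 0 < q) (hq1 : q < 1) {r s : ℝ}
    (hr : 0 < r) (hs : s ≠ 0) (t : ℝ) :
    HasDerivAt (altTheta r s t) (altThetaD r s t q / q) q := by
  obtain ⟨lo, hlo, hlo'⟩ := exists_between hq
  obtain ⟨hi, hhi, hhi'⟩ := exists_between hq1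
  have hhi0 : 0 < hi := hq.trans hhi
  have hS := ((summable_affine_pow_mul_rpow_sq hhi0 hhi' hr hs t 2).mul_left r).mul_right lo⁻¹
  have h0 := (summable_affine_pow_mul_rpow_sq hq hq1 hr hs t 0).neg_one_zpow_mul
  simp only [pow_zero, one_mul] at h0
  have := hasDerivAt_tsum_of_isPreconnected (g := fun (n : ℤ) (q : ℝ) =>
      (-1 : ℝ) ^ n * q ^ (r * (s * n + t) ^ 2))
    (g' := fun (n : ℤ) (q : ℝ) =>
      (-1 : ℝ) ^ n * (r * (s * n + t) ^ 2 * q ^ (r * (s * n + t) ^ 2)) / q)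
    (t := Set.Ioo lo hi) (y₀ := q) (y := q) hS isOpen_Ioo isPreconnected_Ioo ?_ ?_
    ⟨hlo', hhi⟩ h0 ⟨hlo', hhi⟩
  · rw [tsum_div_const] at this
    exact this
  · intro n y hy
    have hy0 : 0 < y := hlo.trans hy.1
    refine ((Real.hasDerivAt_rpow_const (p := r * (s * n + t) ^ 2)
      (Or.inl hy0.ne')).const_mul ((-1 : ℝ) ^ n)).congr_deriv ?_
    rw [rpow_sub_one hy0.ne']
    ring
  · intro n y hy
    have hy0 : 0 < y := hlo.trans hy.1
    rw [norm_div, norm_mul, norm_neg_one_zpow, one_mul, norm_eq_abs, norm_eq_abs, abs_of_pos hy0,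
      abs_of_nonneg (by positivity), div_eq_mul_inv, mul_assoc r]
    gcongr
    · exact hy.2.le
    · exact hy.1.le

theorem continuousOn_altTheta {r s : ℝ} (hr : 0 < r) (hs : s ≠ 0) (t : ℝ) :
    ContinuousOn (altTheta r s t) (Set.Ioo 0 1) := fun _ hq =>
  (hasDerivAt_altTheta hq.1 hq.2 hr hs t).continuousAt.continuousWithinAt

/-- The finite product `(1 - q)(1 - q²)⋯(1 - qⁿ)`. -/
noncomputable def qFact (q : ℝ) (n : ℕ) : ℝ := ∏ k ∈ Finset.range n, (1 - q ^ (k + 1))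

section Euler

variable {q : ℝ}

theorem qFact_succ (n : ℕ) : qFact q (n + 1) = qFact q n * (1 - q ^ (n + 1)) :=
  Finset.prod_range_succ _ _

theorem one_sub_pow_succ_pos (hq : 0 < q) (hq1 : q < 1) (n : ℕ) : 0 < 1 - q ^ (n + 1) :=
  sub_pos.2 (pow_lt_one₀ hq.le hq1 n.succ_ne_zero)

theorem qFact_pos (hq : 0 < q) (hq1 : q < 1) (n : ℕ) : 0 < qFact q n :=
  Finset.prod_pos fun k _ => one_sub_pow_succ_pos hq hq1 k

theorem qFact_antitone (hq : 0 < q) (hq1 : q < 1) : Antitone (qFact q) :=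
  antitone_nat_of_succ_le fun n => by
    rw [qFact_succ]
    exact mul_le_of_le_one_right (qFact_pos hq hq1 n).le (by simp [hq.le])

theorem qFact_le_one (hq : 0 < q) (hq1 : q < 1) (n : ℕ) : qFact q n ≤ 1 := by
  simpa [qFact] using qFact_antitone hq hq1 n.zero_le

theorem summable_norm_neg_pow_succ (hq : 0 < q) (hq1 : q < 1) :
    Summable fun n : ℕ => ‖-q ^ (n + 1)‖ := by
  simp only [norm_neg, norm_pow, norm_of_nonneg hq.le]
  exact (summable_nat_add_iff 1).2 (summable_geometric_of_lt_one hq.le hq1)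

theorem tendsto_qFact (hq : 0 < q) (hq1 : q < 1) :
    Filter.Tendsto (qFact q) Filter.atTop (nhds (eulerF q)) := by
  have := (multipliable_one_add_of_summable
    (summable_norm_neg_pow_succ hq hq1)).hasProd.tendsto_prod_nat
  simp only [← sub_eq_add_neg] at this
  exact this

theorem eulerF_pos (hq : 0 < q) (hq1 : q < 1) : 0 < eulerF q := by
  refine lt_of_le_of_ne (ge_of_tendsto' (tendsto_qFact hq hq1) fun n => (qFact_pos hq hq1 n).le) ?_
  have := tprod_one_add_ne_zero_of_summable (f := fun n : ℕ => -q ^ (n + 1))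
    (fun n => by
      have := one_sub_pow_succ_pos hq hq1 n
      rw [← sub_eq_add_neg]; exact this.ne') (summable_norm_neg_pow_succ hq hq1)
  simp only [← sub_eq_add_neg] at this
  exact this.symm

theorem eulerF_le_qFact (hq : 0 < q) (hq1 : q < 1) (n : ℕ) : eulerF q ≤ qFact q n :=
  (qFact_antitone hq hq1).le_of_tendsto (tendsto_qFact hq hq1) n

/-- The reciprocal of `qFact`, extended by zero to negative integers. -/
noncomputable def qFactInv (q : ℝ) (j : ℤ) : ℝ := if j < 0 then 0 else (qFact q j.toNat)⁻¹

theorem qFactInv_sub_one (hq : 0 < q) (hq1 : q < 1) (j : ℤ) :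
    qFactInv q (j - 1) = (1 - q ^ (j : ℝ)) * qFactInv q j := by
  rcases lt_trichotomy j 0 with h | rfl | h
  · simp [qFactInv, h, h.trans zero_lt_one]
  · simp [qFactInv]
  · obtain ⟨n, rfl⟩ : ∃ n : ℕ, j = n + 1 := ⟨(j - 1).toNat, by omega⟩
    have h1 : ¬ ((n : ℤ) + 1 < 0) := by omega
    have h2 : ((n : ℤ) + 1).toNat = n + 1 := by omega
    have h3 : q ^ ((((n : ℤ) + 1 : ℤ)) : ℝ) = q ^ (n + 1) := by
      rw [← rpow_natCast]; push_cast; rfl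
    have h4 := (one_sub_pow_succ_pos hq hq1 n).ne'
    have h5 := (qFact_pos hq hq1 n).ne'
    simp only [qFactInv, h1, h2, h3, add_sub_cancel_right, qFact_succ, if_false,
      Int.natCast_nonneg, not_lt.2, Int.toNat_natCast]
    field_simp

theorem qFactInv_nonneg (hq : 0 < q) (hq1 : q < 1) (j : ℤ) : 0 ≤ qFactInv q j := by
  unfold qFactInv
  split_ifs
  · rfl
  · exact (inv_pos.2 (qFact_pos hq hq1 _)).le

theorem qFactInv_le (hq : 0 < q) (hq1 : q < 1) (j : ℤ) : qFactInv q j ≤ (eulerF q)⁻¹ := by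
  unfold qFactInv
  have := eulerF_pos hq hq1
  split_ifs
  · positivity
  · gcongr
    exact eulerF_le_qFact hq hq1 _

theorem tendsto_qFactInv (hq : 0 < q) (hq1 : q < 1) :
    Filter.Tendsto (qFactInv q) Filter.atTop (nhds (eulerF q)⁻¹) := by
  have h1 : Filter.Tendsto Int.toNat Filter.atTop Filter.atTop :=
    Filter.tendsto_atTop.2 fun n => by
      filter_upwards [Filter.eventually_ge_atTop (n : ℤ)] with j hj
      omega
  refine (((tendsto_qFact hq hq1).comp h1).inv₀ (eulerF_pos hq hq1).ne').congr' ?_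
  filter_upwards [Filter.eventually_ge_atTop 0] with j hj
  simp [qFactInv, not_lt.2 hj]

/-- The central Gaussian binomial coefficient `[2n; n + j]`. -/
noncomputable def qBinom (q : ℝ) (n : ℕ) (j : ℤ) : ℝ :=
  qFact q (2 * n) * (qFactInv q (n + j) * qFactInv q (n - j))

theorem qBinom_nonneg (hq : 0 < q) (hq1 : q < 1) (n : ℕ) (j : ℤ) : 0 ≤ qBinom q n j :=
  mul_nonneg (qFact_pos hq hq1 _).le
    (mul_nonneg (qFactInv_nonneg hq hq1 _) (qFactInv_nonneg hq hq1 _))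

theorem qBinom_le (hq : 0 < q) (hq1 : q < 1) (n : ℕ) (j : ℤ) :
    qBinom q n j ≤ (eulerF q)⁻¹ * (eulerF q)⁻¹ := by
  have := eulerF_pos hq hq1
  rw [← one_mul ((eulerF q)⁻¹ * _)]
  exact mul_le_mul (qFact_le_one hq hq1 _) (mul_le_mul (qFactInv_le hq hq1 _)
    (qFactInv_le hq hq1 _) (qFactInv_nonneg hq hq1 _) (by positivity))
    (mul_nonneg (qFactInv_nonneg hq hq1 _) (qFactInv_nonneg hq hq1 _)) zero_le_one

theorem tendsto_qBinom (hq : 0 < q) (hq1 : q < 1) (j : ℤ) :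
    Filter.Tendsto (fun n => qBinom q n j) Filter.atTop (nhds (eulerF q)⁻¹) := by
  have h0 := (eulerF_pos hq hq1).ne'
  have h1 := (tendsto_qFact hq hq1).comp
    (Filter.tendsto_id.const_mul_atTop' (two_pos : (0 : ℕ) < 2))
  have h2 := (tendsto_qFactInv hq hq1).comp
    (Filter.tendsto_atTop_add_const_right _ j (tendsto_natCast_atTop_atTop (R := ℤ)))
  have h3 := (tendsto_qFactInv hq hq1).comp
    (Filter.tendsto_atTop_add_const_right _ (-j) (tendsto_natCast_atTop_atTop (R := ℤ)))
  have := h1.mul (h2.mul h3)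
  rw [mul_inv_cancel_left₀ h0] at this
  exact this

theorem qBinom_zero (j : ℤ) : qBinom q 0 j = if j = 0 then 1 else 0 := by
  rcases lt_trichotomy j 0 with h | rfl | h
  · simp [qBinom, qFactInv, h, h.ne]
  · simp [qBinom, qFactInv, qFact]
  · simp [qBinom, qFactInv, h, h.ne']

theorem qBinom_succ (hq : 0 < q) (hq1 : q < 1) (n : ℕ) (j : ℤ) :
    qBinom q (n + 1) j = (1 + q ^ (2 * n + 1)) * qBinom q n j
      + q ^ ((n : ℝ) + 1 - j) * qBinom q n (j - 1) + q ^ ((n : ℝ) + 1 + j) * qBinom q n (j + 1) := by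
  have r := qFactInv_sub_one hq hq1
  have e1 := r (n + 1 + j)
  have e2 := r (n + 1 - j)
  have e3 := r (n + j)
  have e4 := r (n - j)
  have hAB : q ^ ((n : ℝ) + 1 + j) * q ^ ((n : ℝ) + 1 - j) = q ^ (2 * n + 1) * q := by
    rw [← rpow_add hq, ← pow_succ, ← rpow_natCast]
    congr 1
    push_cast
    ring
  have hA : q ^ ((n : ℝ) + 1 + j) = q ^ ((n : ℝ) + j) * q := by
    rw [← rpow_add_one hq.ne']; congr 1; ring
  have hB : q ^ ((n : ℝ) + 1 - j) = q ^ ((n : ℝ) - j) * q := by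
    rw [← rpow_add_one hq.ne']; congr 1; ring
  push_cast at e1 e2 e3 e4
  rw [show (n : ℤ) + 1 + j - 1 = n + j by ring] at e1
  rw [show (n : ℤ) + 1 - j - 1 = n - j by ring] at e2
  rw [show (n : ℤ) + j - 1 = n + (j - 1) by ring, e1] at e3
  rw [show (n : ℤ) - j - 1 = n - (j + 1) by ring, e2] at e4
  have e5 : (n : ℤ) + (j + 1) = n + 1 + j := by ring
  have e6 : (n : ℤ) - (j - 1) = n + 1 - j := by ring
  rw [hA] at e1 e3
  rw [hB] at e2 e4
  simp only [qBinom, e5, e6, e3, e4, e1, e2, show 2 * (n + 1) = 2 * n + 1 + 1 by ring, qFact_succ,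
    Nat.cast_add, Nat.cast_one]
  rw [pow_succ q (2 * n + 1)]
  rw [hA, hB] at hAB
  rw [hA, hB]
  clear e1 e2 e3 e4 hA hB
  generalize q ^ ((n : ℝ) + j) = A at *
  generalize q ^ ((n : ℝ) - j) = B at *
  have hC : q ^ (2 * n + 1) = A * B * q := by
    apply mul_right_cancel₀ hq.ne'
    rw [← hAB]; ring
  rw [hC]
  ring

/-- The terms of the finite form of the Jacobi triple product. -/
noncomputable def tripleTerm (q α : ℝ) (n : ℕ) (j : ℤ) : ℝ :=
  (-1 : ℝ) ^ j * q ^ ((j : ℝ) * (j - 1) / 2 + α * j) * qBinom q n j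

theorem tripleTerm_succ (hq : 0 < q) (hq1 : q < 1) (α : ℝ) (n : ℕ) (j : ℤ) :
    tripleTerm q α (n + 1) j = (1 + q ^ (2 * n + 1)) * tripleTerm q α n j
      - q ^ ((n : ℝ) + α) * tripleTerm q α n (j - 1)
      - q ^ ((n : ℝ) + 1 - α) * tripleTerm q α n (j + 1) := by
  have h1 : (-1 : ℝ) ^ (j - 1) = -(-1) ^ j := by
    rw [zpow_sub_one₀ (by norm_num)]; norm_num
  have h2 : (-1 : ℝ) ^ (j + 1) = -(-1) ^ j := by
    rw [zpow_add_one₀ (by norm_num)]; norm_num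
  have h3 : q ^ ((n : ℝ) + α) * q ^ (((j : ℝ) - 1) * (j - 1 - 1) / 2 + α * (j - 1))
      = q ^ ((j : ℝ) * (j - 1) / 2 + α * j) * q ^ ((n : ℝ) + 1 - j) := by
    rw [← rpow_add hq, ← rpow_add hq]; congr 1; ring
  have h4 : q ^ ((n : ℝ) + 1 - α) * q ^ (((j : ℝ) + 1) * (j + 1 - 1) / 2 + α * (j + 1))
      = q ^ ((j : ℝ) * (j - 1) / 2 + α * j) * q ^ ((n : ℝ) + 1 + j) := by
    rw [← rpow_add hq, ← rpow_add hq]; congr 1; ring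
  simp only [tripleTerm, qBinom_succ hq hq1, h1, h2]
  push_cast
  linear_combination (-(-1 : ℝ) ^ j * qBinom q n (j - 1)) * h3
    - ((-1 : ℝ) ^ j * qBinom q n (j + 1)) * h4

theorem HasSum.of_eq {ι : Type*} {f g : ι → ℝ} {a b : ℝ} (h : HasSum f a)
    (hfg : ∀ i, g i = f i) (hab : b = a) : HasSum g b := by
  rwa [funext hfg, hab]

theorem hasSum_tripleTerm (hq : 0 < q) (hq1 : q < 1) (α : ℝ) (n : ℕ) :
    HasSum (tripleTerm q α n)
      (∏ k ∈ Finset.range n, (1 - q ^ ((k : ℝ) + α)) * (1 - q ^ ((k : ℝ) + 1 - α))) := by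
  induction n with
  | zero =>
    refine (hasSum_ite_eq (0 : ℤ) (1 : ℝ)).of_eq (fun j => ?_) (by simp)
    by_cases h : j = 0 <;> simp [tripleTerm, qBinom_zero, h]
  | succ n ih =>
    have h1 := (Equiv.subRight (1 : ℤ)).hasSum_iff.2 ih
    have h2 := (Equiv.addRight (1 : ℤ)).hasSum_iff.2 ih
    have h := ((ih.mul_left (1 + q ^ (2 * n + 1))).sub (h1.mul_left (q ^ ((n : ℝ) + α)))).sub
      (h2.mul_left (q ^ ((n : ℝ) + 1 - α)))
    have e : q ^ ((n : ℝ) + α) * q ^ ((n : ℝ) + 1 - α) = q ^ (2 * n + 1) := by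
      rw [← rpow_add hq, ← rpow_natCast]; congr 1; push_cast; ring
    refine h.of_eq (fun j => tripleTerm_succ hq hq1 α n j) ?_
    rw [Finset.prod_range_succ, ← e]
    ring

theorem hasSum_mul_tripleTerm_zero (hq : 0 < q) (hq1 : q < 1) (n : ℕ) :
    HasSum (fun j : ℤ => j * tripleTerm q 0 (n + 1) j) (-(qFact q n * qFact q (n + 1))) := by
  have step : ∀ (n : ℕ) (v w : ℝ), HasSum (tripleTerm q 0 n) w →
      HasSum (fun j : ℤ => j * tripleTerm q 0 n j) v →
      HasSum (fun j : ℤ => j * tripleTerm q 0 (n + 1) j)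
        ((1 - q ^ n) * (1 - q ^ (n + 1)) * v - q ^ n * (1 - q) * w) := by
    intro n v w hw hv
    have h1 := (Equiv.subRight (1 : ℤ)).hasSum_iff.2 (hv.add hw)
    have h2 := (Equiv.addRight (1 : ℤ)).hasSum_iff.2 (hv.sub hw)
    have h := ((hv.mul_left (1 + q ^ (2 * n + 1))).sub (h1.mul_left (q ^ n))).sub
      (h2.mul_left (q ^ (n + 1)))
    refine h.of_eq (fun j => ?_) ?_
    · have e1 : q ^ ((n : ℝ) + 0) = q ^ n := by rw [add_zero, rpow_natCast]
      have e2 : q ^ ((n : ℝ) + 1 - 0) = q ^ (n + 1) := by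
        rw [sub_zero, ← rpow_natCast]; push_cast; rfl
      rw [tripleTerm_succ hq hq1, e1, e2]
      simp only [Function.comp_apply, Equiv.subRight_apply, Equiv.coe_addRight]
      push_cast
      ring
    · ring
  induction n with
  | zero =>
    have h := step 0 0 1 (by simpa using hasSum_tripleTerm hq hq1 0 0) (by
      refine hasSum_zero.of_eq (fun j => ?_) rfl
      by_cases h : j = 0 <;> simp [tripleTerm, qBinom_zero, h])
    simpa [qFact] using h
  | succ n ih =>
    have h := step (n + 1) _ 0 (by
      refine (hasSum_tripleTerm hq hq1 0 (n + 1)).of_eq (fun _ => rfl) ?_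
      rw [eq_comm]
      exact Finset.prod_eq_zero (Finset.mem_range.2 n.succ_pos) (by simp)) ih
    refine h.of_eq (fun _ => rfl) ?_
    rw [qFact_succ (n + 1), qFact_succ n]
    ring

/-- The **Jacobi triple product**. -/
theorem tendsto_tripleProduct (hq : 0 < q) (hq1 : q < 1) (α : ℝ) :
    Filter.Tendsto (fun n => ∏ k ∈ Finset.range n,
        (1 - q ^ ((k : ℝ) + α)) * (1 - q ^ ((k : ℝ) + 1 - α))) Filter.atTop
      (nhds ((∑' j : ℤ, (-1 : ℝ) ^ j * q ^ ((j : ℝ) * (j - 1) / 2 + α * j)) * (eulerF q)⁻¹)) := by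
  simp_rw [← (hasSum_tripleTerm hq hq1 α _).tsum_eq, ← tsum_mul_right]
  have hS : Summable fun j : ℤ => q ^ ((j : ℝ) * (j - 1) / 2 + α * j) :=
    (summable_int_pow_mul_rpow_quadratic hq hq1 one_half_pos (α - 1 / 2) 0 0).congr fun j => by
      rw [pow_zero, one_mul]; congr 1; ring
  refine tendsto_tsum_of_dominated_convergence (hS.mul_right ((eulerF q)⁻¹ * (eulerF q)⁻¹))
    (fun j => (tendsto_qBinom hq hq1 j).const_mul _) (Filter.Eventually.of_forall fun n j => ?_)
  rw [tripleTerm, norm_mul, norm_mul, norm_neg_one_zpow, one_mul,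
    norm_of_nonneg (rpow_nonneg hq.le _), norm_of_nonneg (qBinom_nonneg hq hq1 n j)]
  exact mul_le_mul_of_nonneg_left (qBinom_le hq hq1 n j) (rpow_nonneg hq.le _)

/-- **Jacobi's identity** for the cube of Euler's product. -/
theorem eulerF_pow_three (hq : 0 < q) (hq1 : q < 1) :
    eulerF q ^ 3 = -∑' j : ℤ, (-1 : ℝ) ^ j * (j * q ^ ((j : ℝ) * (j - 1) / 2)) := by
  have hS : Summable fun j : ℤ => ‖(j : ℝ) * q ^ ((j : ℝ) * (j - 1) / 2)‖ :=
    ((summable_int_pow_mul_rpow_quadratic hq hq1 one_half_pos (-1 / 2) 0 1).congr fun j => by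
      rw [pow_one]; congr 2; ring).norm
  have h1 : Filter.Tendsto (fun n => ∑' j : ℤ, j * tripleTerm q 0 n j) Filter.atTop
      (nhds (∑' j : ℤ, (-1 : ℝ) ^ j * (j * q ^ ((j : ℝ) * (j - 1) / 2)) * (eulerF q)⁻¹)) := by
    refine tendsto_tsum_of_dominated_convergence (hS.mul_right ((eulerF q)⁻¹ * (eulerF q)⁻¹))
      (fun j => ?_) (Filter.Eventually.of_forall fun n j => ?_)
    · refine ((tendsto_qBinom hq hq1 j).const_mul _).congr fun n => ?_
      rw [tripleTerm, zero_mul, add_zero]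
      ring
    · rw [tripleTerm, zero_mul, add_zero, mul_assoc, mul_left_comm, norm_mul, norm_neg_one_zpow,
        one_mul, ← mul_assoc, norm_mul, norm_of_nonneg (qBinom_nonneg hq hq1 n j)]
      exact mul_le_mul_of_nonneg_left (qBinom_le hq hq1 n j) (norm_nonneg _)
  have h2 := h1.comp (Filter.tendsto_add_atTop_nat 1)
  have h3 := ((tendsto_qFact hq hq1).mul
    ((tendsto_qFact hq hq1).comp (Filter.tendsto_add_atTop_nat 1))).neg
  have h4 := tendsto_nhds_unique h2 (h3.congr fun n =>
    (hasSum_mul_tripleTerm_zero hq hq1 n).tsum_eq.symm)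
  rw [tsum_mul_right] at h4
  have h0 := (eulerF_pos hq hq1).ne'
  rw [← div_eq_mul_inv, div_eq_iff h0] at h4
  rw [h4]
  ring

end Euler

theorem pow_rpow_eq {q : ℝ} (hq : 0 < q) (m : ℕ) (x : ℝ) : (q ^ m) ^ x = q ^ (m * x) := by
  rw [← rpow_natCast, ← rpow_mul hq.le]

/-- The theta series of the Jacobi triple product with argument `q ^ α`. -/
noncomputable def jacobiSeries (q α : ℝ) : ℝ :=
  ∑' j : ℤ, (-1 : ℝ) ^ j * q ^ ((j : ℝ) * (j - 1) / 2 + α * j)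

/-- The series side of the quintuple product identity with argument `q ^ α`. -/
noncomputable def quintupleSeries (q α : ℝ) : ℝ :=
  ∑' n : ℤ, ((-1 : ℝ) ^ n * q ^ ((n : ℝ) * (3 * n - 1) / 2 + 3 * n * α) +
    (-1 : ℝ) ^ n * q ^ ((n : ℝ) * (3 * n - 1) / 2 + (1 - 3 * n) * α))

section Products

variable {q : ℝ}

theorem qFact_three_mul (hq : 0 < q) (n : ℕ) :
    qFact q (3 * n) = qFact (q ^ 3) n * ∏ k ∈ Finset.range n,
      (1 - (q ^ 3) ^ ((k : ℝ) + 1 / 3)) * (1 - (q ^ 3) ^ ((k : ℝ) + 1 - 1 / 3)) := by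
  induction n with
  | zero => simp [qFact]
  | succ n ih =>
    have e1 : (q ^ 3) ^ ((n : ℝ) + 1 / 3) = q ^ (3 * n + 1) := by
      rw [pow_rpow_eq hq, ← rpow_natCast]; congr 1; push_cast; ring
    have e2 : (q ^ 3) ^ ((n : ℝ) + 1 - 1 / 3) = q ^ (3 * n + 2) := by
      rw [pow_rpow_eq hq, ← rpow_natCast]; congr 1; push_cast; ring
    rw [Finset.prod_range_succ, qFact_succ, e1, e2, show 3 * (n + 1) = 3 * n + 1 + 1 + 1 by ring,
      qFact_succ, qFact_succ, qFact_succ, ih]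
    ring

theorem qFact_five_mul (hq : 0 < q) (n : ℕ) :
    qFact q (5 * n) = qFact (q ^ 5) n * (∏ k ∈ Finset.range n,
      (1 - (q ^ 5) ^ ((k : ℝ) + 1 / 5)) * (1 - (q ^ 5) ^ ((k : ℝ) + 1 - 1 / 5))) *
      ∏ k ∈ Finset.range n,
      (1 - (q ^ 5) ^ ((k : ℝ) + 2 / 5)) * (1 - (q ^ 5) ^ ((k : ℝ) + 1 - 2 / 5)) := by
  induction n with
  | zero => simp [qFact]
  | succ n ih =>
    have e1 : (q ^ 5) ^ ((n : ℝ) + 1 / 5) = q ^ (5 * n + 1) := by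
      rw [pow_rpow_eq hq, ← rpow_natCast]; congr 1; push_cast; ring
    have e2 : (q ^ 5) ^ ((n : ℝ) + 2 / 5) = q ^ (5 * n + 2) := by
      rw [pow_rpow_eq hq, ← rpow_natCast]; congr 1; push_cast; ring
    have e3 : (q ^ 5) ^ ((n : ℝ) + 1 - 2 / 5) = q ^ (5 * n + 3) := by
      rw [pow_rpow_eq hq, ← rpow_natCast]; congr 1; push_cast; ring
    have e4 : (q ^ 5) ^ ((n : ℝ) + 1 - 1 / 5) = q ^ (5 * n + 4) := by
      rw [pow_rpow_eq hq, ← rpow_natCast]; congr 1; push_cast; ring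
    rw [Finset.prod_range_succ, Finset.prod_range_succ, qFact_succ, e1, e2, e3, e4,
      show 5 * (n + 1) = 5 * n + 1 + 1 + 1 + 1 + 1 by ring,
      qFact_succ, qFact_succ, qFact_succ, qFact_succ, qFact_succ, ih]
    ring

/-- Euler's **pentagonal number theorem**. -/
theorem eulerF_eq_tsum (hq : 0 < q) (hq1 : q < 1) :
    eulerF q = ∑' n : ℤ, (-1 : ℝ) ^ n * q ^ ((n : ℝ) * (3 * n - 1) / 2) := by
  have hQ : 0 < q ^ 3 := by positivity
  have hQ1 : q ^ 3 < 1 := pow_lt_one₀ hq.le hq1 (by norm_num)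
  have h1 := (tendsto_qFact hq hq1).comp
    (Filter.tendsto_id.const_mul_atTop' (three_pos : (0 : ℕ) < 3))
  have h2 := (tendsto_qFact hQ hQ1).mul (tendsto_tripleProduct hQ hQ1 (1 / 3))
  rw [tendsto_nhds_unique h1 (h2.congr fun n => (qFact_three_mul hq n).symm),
    mul_left_comm, mul_inv_cancel₀ (eulerF_pos hQ hQ1).ne', mul_one]
  refine tsum_congr fun n => ?_
  rw [pow_rpow_eq hq]
  congr 2
  push_cast
  ring

theorem jacobiSeries_mul_jacobiSeries (hq : 0 < q) (hq1 : q < 1) :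
    jacobiSeries (q ^ 5) (1 / 5) * jacobiSeries (q ^ 5) (2 / 5) = eulerF q * eulerF (q ^ 5) := by
  have hQ : 0 < q ^ 5 := by positivity
  have hQ1 : q ^ 5 < 1 := pow_lt_one₀ hq.le hq1 (by norm_num)
  have h1 := (tendsto_qFact hq hq1).comp
    (Filter.tendsto_id.const_mul_atTop' (Nat.succ_pos 4 : (0 : ℕ) < 5))
  have h2 := ((tendsto_qFact hQ hQ1).mul (tendsto_tripleProduct hQ hQ1 (1 / 5))).mul
    (tendsto_tripleProduct hQ hQ1 (2 / 5))
  rw [tendsto_nhds_unique h1 (h2.congr fun n => (qFact_five_mul hq n).symm)]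
  have := (eulerF_pos hQ hQ1).ne'
  rw [mul_comm (eulerF (q ^ 5)), inv_mul_cancel_right₀ this, mul_assoc, inv_mul_cancel_right₀ this]
  rfl

theorem jacobiSeries_nonneg (hq : 0 < q) (hq1 : q < 1) {α : ℝ} (hα : 0 < α) (hα1 : α < 1) :
    0 ≤ jacobiSeries q α := by
  have h : 0 ≤ jacobiSeries q α * (eulerF q)⁻¹ :=
    ge_of_tendsto' (tendsto_tripleProduct hq hq1 α) fun n =>
      Finset.prod_nonneg fun k _ => by
        have hk : (0 : ℝ) ≤ k := k.cast_nonneg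
        exact mul_nonneg (sub_nonneg.2 (rpow_le_one hq.le hq1.le (by linarith)))
          (sub_nonneg.2 (rpow_le_one hq.le hq1.le (by linarith)))
  exact nonneg_of_mul_nonneg_left h (inv_pos.2 (eulerF_pos hq hq1))

theorem jacobiSeries_one_sub (α : ℝ) : jacobiSeries q (1 - α) = jacobiSeries q α := by
  rw [jacobiSeries, ← (Equiv.neg ℤ).tsum_eq]
  refine tsum_congr fun n => ?_
  rw [Equiv.neg_apply, zpow_neg, ← inv_zpow, inv_neg_one]
  congr 2
  push_cast
  ring

theorem summable_signed_quadratic (hq : 0 < q) (hq1 : q < 1) {a : ℝ} (ha : 0 < a) (b c : ℝ)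
    {e : ℤ → ℝ} (he : ∀ n : ℤ, e n = a * (n : ℝ) ^ 2 + b * n + c) :
    Summable fun n : ℤ => (-1 : ℝ) ^ n * q ^ e n := by
  simp only [he]
  simpa using (summable_int_pow_mul_rpow_quadratic hq hq1 ha b c 0).neg_one_zpow_mul

theorem signed_mul (hq : 0 < q) (m n : ℤ) (x y : ℝ) :
    ((-1 : ℝ) ^ m * q ^ x) * ((-1 : ℝ) ^ n * q ^ y) = (-1 : ℝ) ^ (m + n) * q ^ (x + y) := by
  rw [zpow_add₀ (by norm_num), rpow_add hq]
  ring

/-- The **quintuple product identity**, multiplied out into theta series. -/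
theorem quintupleSeries_mul_jacobiSeries (hq : 0 < q) (hq1 : q < 1) (α : ℝ) :
    quintupleSeries q α * jacobiSeries q α = eulerF q * jacobiSeries q (2 * α) := by
  have hA : Summable fun n : ℤ => (-1 : ℝ) ^ n * q ^ ((n : ℝ) * (3 * n - 1) / 2 + 3 * n * α) :=
    summable_signed_quadratic hq hq1 (a := 3 / 2) (by norm_num) (-1 / 2 + 3 * α) 0
      fun n => by ring
  have hB : Summable fun n : ℤ =>
      (-1 : ℝ) ^ n * q ^ ((n : ℝ) * (3 * n - 1) / 2 + (1 - 3 * n) * α) :=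
    summable_signed_quadratic hq hq1 (a := 3 / 2) (by norm_num) (-1 / 2 - 3 * α) α
      fun n => by ring
  have hE : Summable fun n : ℤ => (-1 : ℝ) ^ n * q ^ ((n : ℝ) * (3 * n - 1) / 2) :=
    summable_signed_quadratic hq hq1 (a := 3 / 2) (by norm_num) (-1 / 2) 0 fun n => by ring
  have hJ (β : ℝ) : Summable fun n : ℤ => (-1 : ℝ) ^ n * q ^ ((n : ℝ) * (n - 1) / 2 + β * n) :=
    summable_signed_quadratic hq hq1 (a := 1 / 2) (by norm_num) (-1 / 2 + β) 0 fun n => by ring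
  have sA := summable_mul_of_summable_norm hA.norm (hJ α).norm
  have sB := summable_mul_of_summable_norm hB.norm (hJ α).norm
  have sE := summable_mul_of_summable_norm hE.norm (hJ (2 * α)).norm
  rw [eulerF_eq_tsum hq hq1, quintupleSeries, hA.tsum_add hB, add_mul]
  simp only [jacobiSeries]
  rw [hA.tsum_mul_tsum (hJ α) sA, hB.tsum_mul_tsum (hJ α) sB, hE.tsum_mul_tsum (hJ (2 * α)) sE]
  simp only [signed_mul hq] at sA sB sE ⊢
  have pA := tsum_eq_add_tsum_of_bijective (fun x : ℤ × ℤ => (x.1, 2 * x.2 - 3 * x.1))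
    (fun x : ℤ × ℤ => (x.1, 2 * x.2 + 1 - 3 * x.1))
    (by rintro ⟨a, b⟩ ⟨c, d⟩ h; grind)
    (by rintro ⟨a, b⟩ ⟨c, d⟩ h; grind)
    (by rintro ⟨a, b⟩ ⟨c, d⟩ h; simp only [Prod.mk.injEq] at h; omega)
    (by
      rintro ⟨a, b⟩
      rcases Int.even_or_odd' (a + b) with ⟨c, h | h⟩
      · exact Or.inl ⟨(a, c + a), by grind⟩
      · exact Or.inr ⟨(a, c + a), by grind⟩) sA
  have pB := tsum_eq_add_tsum_of_bijective (fun x : ℤ × ℤ => (x.1 - x.2, 3 * x.1 - x.2))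
    (fun x : ℤ × ℤ => (x.1, 2 * x.2 - 1 + 3 * x.1))
    (by rintro ⟨a, b⟩ ⟨c, d⟩ h; grind)
    (by rintro ⟨a, b⟩ ⟨c, d⟩ h; grind)
    (by rintro ⟨a, b⟩ ⟨c, d⟩ h; simp only [Prod.mk.injEq] at h; omega)
    (by
      rintro ⟨a, b⟩
      rcases Int.even_or_odd' (a + b) with ⟨c, h | h⟩
      · exact Or.inl ⟨(c - a, c - 2 * a), by grind⟩
      · exact Or.inr ⟨(a, c + 1 - 2 * a), by grind⟩) sB
  have pE := tsum_eq_add_tsum_of_bijective (fun x : ℤ × ℤ => (x.2 - 2 * x.1, x.2))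
    (fun x : ℤ × ℤ => (1 - x.2 - 2 * x.1, x.2))
    (by rintro ⟨a, b⟩ ⟨c, d⟩ h; grind)
    (by rintro ⟨a, b⟩ ⟨c, d⟩ h; grind)
    (by rintro ⟨a, b⟩ ⟨c, d⟩ h; simp only [Prod.mk.injEq] at h; omega)
    (by
      rintro ⟨a, b⟩
      rcases Int.even_or_odd' (a + b) with ⟨c, h | h⟩
      · exact Or.inl ⟨(b - c, b), by grind⟩
      · exact Or.inr ⟨(-c, b), by grind⟩) sE
  rw [pA, pB, pE]
  have e1 : ∀ n t : ℤ, (-1 : ℝ) ^ (n + (2 * t - 3 * n)) = 1 := fun n t =>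
    Even.neg_one_zpow ⟨t - n, by ring⟩
  have e2 : ∀ n t : ℤ, (-1 : ℝ) ^ (n + (2 * t + 1 - 3 * n)) = -1 := fun n t =>
    Odd.neg_one_zpow ⟨t - n, by ring⟩
  have e3 : ∀ n t : ℤ, (-1 : ℝ) ^ (n + (2 * t - 1 + 3 * n)) = -1 := fun n t =>
    Odd.neg_one_zpow ⟨t + 2 * n - 1, by ring⟩
  have e4 : ∀ n t : ℤ, (-1 : ℝ) ^ (n - t + (3 * n - t)) = 1 := fun n t =>
    Even.neg_one_zpow ⟨2 * n - t, by ring⟩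
  have e5 : ∀ n t : ℤ, (-1 : ℝ) ^ (t - 2 * n + t) = 1 := fun n t =>
    Even.neg_one_zpow ⟨t - n, by ring⟩
  have e6 : ∀ n t : ℤ, (-1 : ℝ) ^ (1 - t - 2 * n + t) = -1 := fun n t =>
    Odd.neg_one_zpow ⟨-n, by ring⟩
  simp only [e1, e2, e3, e4, e5, e6, one_mul, neg_mul, tsum_neg]
  have key : ∀ a b c d e f : ℝ, a = e → c = f → b = d → a + -b + (d + -c) = e + -f := by
    rintro a b c d e f rfl rfl rfl
    ring
  refine key _ _ _ _ _ _ (tsum_congr ?_) (tsum_congr ?_) (tsum_congr ?_) <;>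
  · rintro ⟨n, t⟩
    congr 1
    push_cast
    ring

/-- The dissection of Euler's product modulo five. -/
theorem eulerF_rpow_one_fifth (hq : 0 < q) (hq1 : q < 1) :
    eulerF (q ^ ((1 : ℝ) / 5)) = quintupleSeries (q ^ 5) (1 / 5)
      - q ^ ((1 : ℝ) / 5) * eulerF (q ^ 5)
      - (q ^ ((1 : ℝ) / 5)) ^ 2 * quintupleSeries (q ^ 5) (2 / 5) := by
  have hQ : 0 < q ^ 5 := by positivity
  have hQ1 : q ^ 5 < 1 := pow_lt_one₀ hq.le hq1 (by norm_num)
  have hp : 0 < q ^ ((1 : ℝ) / 5) := rpow_pos_of_pos hq _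
  have hp1 : q ^ ((1 : ℝ) / 5) < 1 := rpow_lt_one hq.le hq1 (by norm_num)
  have hS : Summable fun n : ℤ =>
      (-1 : ℝ) ^ n * (q ^ ((1 : ℝ) / 5)) ^ ((n : ℝ) * (3 * n - 1) / 2) :=
    summable_signed_quadratic hp hp1 (a := 3 / 2) (by norm_num) (-1 / 2) 0 fun n => by ring
  have hA (α : ℝ) : Summable fun n : ℤ =>
      (-1 : ℝ) ^ n * (q ^ 5) ^ ((n : ℝ) * (3 * n - 1) / 2 + 3 * n * α) :=
    summable_signed_quadratic hQ hQ1 (a := 3 / 2) (by norm_num) (-1 / 2 + 3 * α) 0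
      fun n => by ring
  have hB (α : ℝ) : Summable fun n : ℤ =>
      (-1 : ℝ) ^ n * (q ^ 5) ^ ((n : ℝ) * (3 * n - 1) / 2 + (1 - 3 * n) * α) :=
    summable_signed_quadratic hQ hQ1 (a := 3 / 2) (by norm_num) (-1 / 2 - 3 * α) α
      fun n => by ring
  rw [eulerF_eq_tsum hp hp1, eulerF_eq_tsum hQ hQ1, quintupleSeries, quintupleSeries,
    (hA _).tsum_add (hB _), (hA _).tsum_add (hB _),
    tsum_eq_sum_tsum_of_bijective
      (fun (i : Fin 5) (n : ℤ) => (![0, 1, 2, 3, -1] : Fin 5 → ℤ) i - 5 * n) ⟨?_, ?_⟩ hS,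
    Fin.sum_univ_five]
  · have key : ∀ a b c d e a' b' c' d' e' P : ℝ, a = a' → b = -(P * b') → c = c' →
        d = -(P ^ 2 * d') → e = -(P ^ 2 * e') →
        a + b + c + d + e = a' + c' - P * b' - P ^ 2 * (e' + d') := by
      rintro a b c d e a' b' c' d' e' P rfl rfl rfl rfl rfl
      ring
    have z : ∀ k n : ℤ, (-1 : ℝ) ^ (k - 5 * n) = (-1) ^ k * (-1) ^ n := fun k n => by
      rw [show k - 5 * n = k + n + 2 * (-3 * n) by ring, zpow_add₀ (by norm_num),
        zpow_add₀ (by norm_num), zpow_mul]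
      norm_num
    have hP : (q ^ ((1 : ℝ) / 5)) ^ 2 = q ^ ((2 : ℝ) / 5) := by
      rw [← rpow_natCast, ← rpow_mul hq.le]; norm_num
    refine key _ _ _ _ _ _ _ _ _ _ _ ?_ ?_ ?_ ?_ ?_
    all_goals
      try rw [← tsum_mul_left, ← tsum_neg]
      refine tsum_congr fun n => ?_
      simp only [z, hP]
      simp only [Matrix.cons_val, Matrix.cons_val_zero, Matrix.cons_val_one]
      rw [← rpow_mul hq.le, pow_rpow_eq hq]
      try rw [mul_left_comm, ← rpow_add hq]
      norm_num
      try exact Or.inl (by ring_nf)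
  · rintro ⟨i, n⟩ ⟨j, m⟩ h
    fin_cases i <;> fin_cases j <;> simp at h ⊢ <;> omega
  · intro n
    have h : n % 5 = 0 ∨ n % 5 = 1 ∨ n % 5 = 2 ∨ n % 5 = 3 ∨ n % 5 = 4 := by omega
    rcases h with h | h | h | h | h
    · exact ⟨(0, -(n / 5)), by simp; omega⟩
    · exact ⟨(1, -(n / 5)), by simp; omega⟩
    · exact ⟨(2, -(n / 5)), by simp; omega⟩
    · exact ⟨(3, -(n / 5)), by simp; omega⟩
    · exact ⟨(4, -(n / 5) - 1), by simp; omega⟩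

end Products

section Lattice

variable {q : ℝ}

theorem summable_mul_affine_pow_mul_rpow_sq (hq : 0 < q) (hq1 : q < 1) {r s s' : ℝ} (hr : 0 < r)
    (hs : s ≠ 0) (hs' : s' ≠ 0) (t t' : ℝ) (k l : ℕ) :
    Summable fun x : ℤ × ℤ => (s * x.1 + t) ^ k * (s' * x.2 + t') ^ l *
      q ^ (r * ((s * x.1 + t) ^ 2 + (s' * x.2 + t') ^ 2)) := by
  refine (summable_mul_of_summable_norm (summable_affine_pow_mul_rpow_sq hq hq1 hr hs t k).norm
    (summable_affine_pow_mul_rpow_sq hq hq1 hr hs' t' l).norm).congr fun x => ?_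
  rw [mul_add r, rpow_add hq]
  ring

theorem tsum_eq_zero_of_equiv_neg {α : Type*} (e : α ≃ α) {f : α → ℝ} (h : ∀ a, f (e a) = -f a) :
    ∑' a, f a = 0 := by
  have := e.tsum_eq f
  simp only [h, tsum_neg] at this
  linarith

theorem eulerF_pow_three_eq_tsum_odd (hq : 0 < q) (hq1 : q < 1) :
    eulerF q ^ 3 * q ^ ((1 : ℝ) / 8) = -∑' j : ℤ, (4 * (j : ℝ) + -1) ^ 1 *
      q ^ ((1 : ℝ) / 8 * (4 * j + -1) ^ 2) := by
  have hS : Summable fun j : ℤ => (-1 : ℝ) ^ j * ((j : ℝ) * q ^ ((j : ℝ) * (j - 1) / 2)) :=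
    ((summable_int_pow_mul_rpow_quadratic hq hq1 one_half_pos (-1 / 2) 0 1).congr fun j => by
      rw [pow_one]; congr 2; ring).neg_one_zpow_mul
  rw [eulerF_pow_three hq hq1, tsum_eq_add_tsum_of_bijective (fun j : ℤ => 2 * j)
    (fun j : ℤ => 1 - 2 * j) (fun a b h => by grind) (fun a b h => by grind)
    (fun a b h => by grind) ?_ hS, ← Summable.tsum_add, neg_mul, ← tsum_mul_right]
  · congr 1
    refine tsum_congr fun j => ?_
    rw [Even.neg_one_zpow ⟨j, by ring⟩, Odd.neg_one_zpow ⟨-j, by ring⟩]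
    rw [show (1 : ℝ) / 8 * (4 * j + -1) ^ 2 = ((2 * j : ℤ) : ℝ) * ((2 * j : ℤ) - 1) / 2 + 1 / 8 by
      push_cast; ring, rpow_add hq]
    rw [show ((1 - 2 * j : ℤ) : ℝ) * ((1 - 2 * j : ℤ) - 1) / 2 =
      ((2 * j : ℤ) : ℝ) * ((2 * j : ℤ) - 1) / 2 by push_cast; ring]
    push_cast
    ring
  · exact hS.comp_injective (i := fun j : ℤ => 2 * j) fun a b h => by grind
  · exact hS.comp_injective (i := fun j : ℤ => 1 - 2 * j) fun a b h => by grind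
  · intro b
    rcases Int.even_or_odd' b with ⟨c, h | h⟩
    · exact Or.inl ⟨c, h.symm⟩
    · exact Or.inr ⟨-c, by grind⟩

theorem summable_sq_sub_sq_mul_rpow (hq : 0 < q) (hq1 : q < 1) :
    Summable fun x : ℤ × ℤ => ((2 * (x.1 : ℝ) + -1) ^ 2 - (2 * (x.2 : ℝ)) ^ 2) *
      q ^ ((1 : ℝ) / 4 * ((2 * x.1 + -1) ^ 2 + (2 * x.2) ^ 2)) := by
  have h := summable_mul_affine_pow_mul_rpow_sq hq hq1 (r := 1 / 4) (by norm_num)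
    two_ne_zero two_ne_zero (-1) 0
  refine ((h 2 0).sub (h 0 2)).congr fun x => ?_
  simp only [add_zero, pow_zero]
  ring

theorem tsum_sq_sub_sq_mul_rpow (hq : 0 < q) (hq1 : q < 1) :
    ∑' x : ℤ × ℤ, ((2 * (x.1 : ℝ) + -1) ^ 2 - (2 * (x.2 : ℝ)) ^ 2) *
      q ^ ((1 : ℝ) / 4 * ((2 * x.1 + -1) ^ 2 + (2 * x.2) ^ 2)) =
      2 * (eulerF q ^ 6 * q ^ ((1 : ℝ) / 4)) := by
  have hS := summable_sq_sub_sq_mul_rpow hq hq1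
  have hJ := summable_affine_pow_mul_rpow_sq hq hq1 (r := 1 / 8) (by norm_num) four_ne_zero (-1) 1
  have hE : eulerF q ^ 6 * q ^ ((1 : ℝ) / 4) =
      (eulerF q ^ 3 * q ^ ((1 : ℝ) / 8)) * (eulerF q ^ 3 * q ^ ((1 : ℝ) / 8)) := by
    rw [mul_mul_mul_comm, ← rpow_add hq]
    ring_nf
  rw [hE, eulerF_pow_three_eq_tsum_odd hq hq1, neg_mul_neg,
    tsum_mul_tsum_of_summable_norm hJ.norm hJ.norm,
    tsum_eq_add_tsum_of_bijective (fun x : ℤ × ℤ => (x.1 + x.2, x.1 - x.2))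
    (fun x : ℤ × ℤ => (1 - x.1 - x.2, x.1 - x.2))
    (by rintro ⟨a, b⟩ ⟨c, d⟩ h; grind) (by rintro ⟨a, b⟩ ⟨c, d⟩ h; grind)
    (by rintro ⟨a, b⟩ ⟨c, d⟩ h; grind) ?_ hS, two_mul]
  · have e (x : ℝ) (i j : ℤ) (hx : x ^ 2 = (2 * ((i : ℝ) + j) - 1) ^ 2) :
        (x ^ 2 - (2 * ((i : ℝ) - j)) ^ 2) *
          q ^ ((1 : ℝ) / 4 * (x ^ 2 + (2 * ((i : ℝ) - j)) ^ 2)) =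
        ((4 * (i : ℝ) + -1) ^ 1 * q ^ ((1 : ℝ) / 8 * (4 * i + -1) ^ 2)) *
          ((4 * (j : ℝ) + -1) ^ 1 * q ^ ((1 : ℝ) / 8 * (4 * j + -1) ^ 2)) := by
      rw [mul_mul_mul_comm, ← rpow_add hq, hx]
      congr 1
      · ring
      · congr 1
        ring
    congr 1
    all_goals
      refine tsum_congr fun ⟨i, j⟩ => ?_
      push_cast
      exact e _ i j (by ring)
  · rintro ⟨a, b⟩
    rcases Int.even_or_odd' (a + b) with ⟨c, h | h⟩
    · exact Or.inl ⟨(c, a - c), by grind⟩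
    · exact Or.inr ⟨(b - c, -c), by grind⟩

/-- The summand of the lattice sums attached to the Gaussian integers divisible by `2 + i`. -/
noncomputable def latticeTerm (q u w : ℝ) : ℝ := u * w * q ^ ((1 : ℝ) / 20 * (u ^ 2 + w ^ 2))

theorem latticeTerm_neg_left (u w : ℝ) : latticeTerm q (-u) w = -latticeTerm q u w := by
  simp [latticeTerm]

theorem latticeTerm_neg_neg (u w : ℝ) : latticeTerm q (-u) (-w) = latticeTerm q u w := by
  simp [latticeTerm]

theorem latticeTerm_comm (u w : ℝ) : latticeTerm q u w = latticeTerm q w u := by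
  rw [latticeTerm, latticeTerm, mul_comm u, add_comm (u ^ 2)]

theorem summable_latticeTerm_rotated (hq : 0 < q) (hq1 : q < 1) :
    Summable fun x : ℤ × ℤ => latticeTerm q (4 * x.1 - 2 - 2 * x.2) (2 * x.1 - 1 + 4 * x.2) := by
  have h := summable_mul_affine_pow_mul_rpow_sq hq hq1 (r := 1 / 4) (by norm_num)
    two_ne_zero two_ne_zero (-1) 0
  refine ((((h 2 0).sub (h 0 2)).mul_left 2).add ((h 1 1).mul_left 3)).congr fun x => ?_
  rw [latticeTerm, show (1 : ℝ) / 20 * ((4 * x.1 - 2 - 2 * x.2) ^ 2 + (2 * x.1 - 1 + 4 * x.2) ^ 2) =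
    1 / 4 * ((2 * x.1 + -1) ^ 2 + (2 * x.2 + 0) ^ 2) by ring]
  ring

theorem tsum_latticeTerm_rotated (hq : 0 < q) (hq1 : q < 1) :
    ∑' x : ℤ × ℤ, latticeTerm q (4 * x.1 - 2 - 2 * x.2) (2 * x.1 - 1 + 4 * x.2) =
      4 * (eulerF q ^ 6 * q ^ ((1 : ℝ) / 4)) := by
  have h := summable_mul_affine_pow_mul_rpow_sq hq hq1 (r := 1 / 4) (by norm_num)
    two_ne_zero two_ne_zero (-1) 0
  have hS := summable_sq_sub_sq_mul_rpow hq hq1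
  have h0 := tsum_eq_zero_of_equiv_neg ((Equiv.refl ℤ).prodCongr (Equiv.neg ℤ))
    (f := fun x : ℤ × ℤ => (2 * (x.1 : ℝ) + -1) ^ 1 * (2 * (x.2 : ℝ) + 0) ^ 1 *
      q ^ ((1 : ℝ) / 4 * ((2 * x.1 + -1) ^ 2 + (2 * x.2 + 0) ^ 2))) fun x => by
    simp
  have hs := (hS.mul_left 2).tsum_add ((h 1 1).mul_left 3)
  rw [tsum_mul_left, tsum_mul_left, h0, mul_zero, add_zero, tsum_sq_sub_sq_mul_rpow hq hq1] at hs
  rw [show 4 * (eulerF q ^ 6 * q ^ ((1 : ℝ) / 4)) = 2 * (2 * (eulerF q ^ 6 * q ^ ((1 : ℝ) / 4))) by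
    ring, ← hs]
  refine tsum_congr fun x => ?_
  rw [latticeTerm, show (1 : ℝ) / 20 *
    ((4 * x.1 - 2 - 2 * x.2) ^ 2 + (2 * x.1 - 1 + 4 * x.2) ^ 2) =
    1 / 4 * ((2 * x.1 + -1) ^ 2 + (2 * x.2 + 0) ^ 2) by ring]
  ring_nf

theorem tsum_latticeTerm_add (hq : 0 < q) (hq1 : q < 1) :
    ∑' x : ℤ × ℤ, latticeTerm q (10 * x.1 - 2) (10 * x.2 - 1) +
      ∑' x : ℤ × ℤ, latticeTerm q (10 * x.1 + 4) (10 * x.2 - 3) =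
      2 * (eulerF q ^ 6 * q ^ ((1 : ℝ) / 4)) := by
  have hS := tsum_latticeTerm_rotated hq hq1
  rw [tsum_eq_sum_tsum_of_bijective (fun (k : Fin 5) (x : ℤ × ℤ) =>
      ((2 * x.1 + x.2 + (![1, 1, 0, 1, 0] : Fin 5 → ℤ) k,
        2 * x.2 - x.1 + (![1, 0, 0, -1, 1] : Fin 5 → ℤ) k) : ℤ × ℤ)) ⟨?_, ?_⟩
      (summable_latticeTerm_rotated hq hq1), Fin.sum_univ_five] at hS
  · have h0 := tsum_eq_zero_of_equiv_neg ((Equiv.neg ℤ).prodCongr (Equiv.refl ℤ))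
      (f := fun x : ℤ × ℤ => latticeTerm q (10 * x.1) (10 * x.2 + 5)) fun x => by
      simp [latticeTerm_neg_left]
    have h1 := ((Equiv.neg ℤ).prodCongr (Equiv.neg ℤ)).tsum_eq
      fun x : ℤ × ℤ => latticeTerm q (10 * x.1 - 2) (10 * x.2 - 1)
    have h2 := ((Equiv.neg ℤ).prodCongr (Equiv.neg ℤ)).tsum_eq
      fun x : ℤ × ℤ => latticeTerm q (10 * x.1 + 4) (10 * x.2 - 3)
    have key : ∀ a b c d e b' d' s : ℝ, a + b + c + d + e = 4 * s → a = 0 → b = c → e = d →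
        c = b' → d = d' → b' + d' = 2 * s := by
      intros; linarith
    refine key _ _ _ _ _ _ _ _ hS (Eq.trans ?_ h0) (Eq.trans ?_ (h1.trans ?_))
      (Eq.trans ?_ (h2.trans ?_)) ?_ ?_
    all_goals
      refine tsum_congr fun x => ?_
      simp only [Matrix.cons_val, Matrix.cons_val_zero, Matrix.cons_val_one, Equiv.prodCongr_apply,
        Prod.map_fst, Prod.map_snd, Equiv.neg_apply]
      push_cast
      first
        | ring_nf; done
        | rw [← latticeTerm_neg_neg]; ring_nf
  · rintro ⟨i, n⟩ ⟨j, m⟩ h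
    fin_cases i <;> fin_cases j <;> simp at h ⊢ <;> grind
  · rintro ⟨a, b⟩
    have h : (a + 2 * b) % 5 = 0 ∨ (a + 2 * b) % 5 = 1 ∨ (a + 2 * b) % 5 = 2 ∨
      (a + 2 * b) % 5 = 3 ∨ (a + 2 * b) % 5 = 4 := by omega
    rcases h with h | h | h | h | h
    · exact ⟨(2, ((2 * a - b) / 5, (a + 2 * b) / 5)), by simp; omega⟩
    · exact ⟨(1, ((2 * a - b) / 5, (a + 2 * b) / 5)), by simp; omega⟩
    · exact ⟨(4, ((2 * a - b + 1) / 5, (a + 2 * b) / 5)), by simp; omega⟩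
    · exact ⟨(0, ((2 * a - b - 1) / 5, (a + 2 * b) / 5)), by simp; omega⟩
    · exact ⟨(3, ((2 * a - b - 3) / 5, (a + 2 * b + 1) / 5)), by simp; omega⟩

theorem altThetaD_mul_sub (hq : 0 < q) (hq1 : q < 1) :
    altThetaD (1 / 40) 10 (-3) q * altTheta (1 / 40) 10 (-1) q -
      altTheta (1 / 40) 10 (-3) q * altThetaD (1 / 40) 10 (-1) q =
      1 / 5 * (eulerF q ^ 6 * q ^ ((1 : ℝ) / 4)) := by
  have h0 (t : ℝ) := (summable_affine_pow_mul_rpow_sq hq hq1 (r := 1 / 40) (by norm_num)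
    (show (10 : ℝ) ≠ 0 by norm_num) t 0).neg_one_zpow_mul
  have h2 (t : ℝ) := (((summable_affine_pow_mul_rpow_sq hq hq1 (r := 1 / 40) (by norm_num)
    (show (10 : ℝ) ≠ 0 by norm_num) t 2)).mul_left (1 / 40)).neg_one_zpow_mul
  simp only [pow_zero, one_mul] at h0
  simp only [← mul_assoc (1 / 40 : ℝ)] at h2
  have e (m n : ℤ) : ((-1 : ℝ) ^ m * (1 / 40 * (10 * m + -3) ^ 2 *
        q ^ ((1 / 40 : ℝ) * (10 * m + -3) ^ 2))) *
        ((-1 : ℝ) ^ n * q ^ ((1 / 40 : ℝ) * (10 * n + -1) ^ 2)) -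
      ((-1 : ℝ) ^ m * q ^ ((1 / 40 : ℝ) * (10 * m + -3) ^ 2)) *
        ((-1 : ℝ) ^ n * (1 / 40 * (10 * n + -1) ^ 2 * q ^ ((1 / 40 : ℝ) * (10 * n + -1) ^ 2))) =
      1 / 10 * ((-1 : ℝ) ^ (m + n) *
        latticeTerm q (5 * (m + n) - 2) (5 * (m - n) - 1)) := by
    rw [latticeTerm, show (1 : ℝ) / 20 * ((5 * (m + n) - 2) ^ 2 + (5 * (m - n) - 1) ^ 2) =
      1 / 40 * (10 * m + -3) ^ 2 + 1 / 40 * (10 * n + -1) ^ 2 by ring, rpow_add hq,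
      zpow_add₀ (by norm_num)]
    ring
  have s1 := summable_mul_of_summable_norm (h2 (-3)).norm (h0 (-1)).norm
  have s2 := summable_mul_of_summable_norm (h0 (-3)).norm (h2 (-1)).norm
  have sW := (s1.sub s2).congr fun x => (e x.1 x.2)
  have sW' := (summable_mul_left_iff (by norm_num)).1 sW
  simp only [altTheta, altThetaD]
  rw [(h2 (-3)).tsum_mul_tsum (h0 (-1)) s1, (h0 (-3)).tsum_mul_tsum (h2 (-1)) s2,
    ← s1.tsum_sub s2, tsum_congr fun x : ℤ × ℤ => e x.1 x.2, tsum_mul_left,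
    tsum_eq_add_tsum_of_bijective (fun x : ℤ × ℤ => (x.1 + x.2, x.1 - x.2))
    (fun x : ℤ × ℤ => (x.1 - x.2 + 1, - x.2 - x.1))
    (by rintro ⟨a, b⟩ ⟨c, d⟩ h; grind) (by rintro ⟨a, b⟩ ⟨c, d⟩ h; grind)
    (by rintro ⟨a, b⟩ ⟨c, d⟩ h; grind) ?_ sW']
  · have key : ∀ a b a' b' s : ℝ, a' + b' = 2 * s → a = a' → b = b' →
        1 / 10 * (a + b) = 1 / 5 * s := by
      intros; subst_vars; linarith
    refine key _ _ _ _ _ (tsum_latticeTerm_add hq hq1) ?_ ?_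
    · refine tsum_congr fun x => ?_
      rw [Even.neg_one_zpow ⟨x.1, by ring⟩, one_mul]
      push_cast
      ring_nf
    · refine tsum_congr fun x => ?_
      rw [Odd.neg_one_zpow ⟨-x.2, by ring⟩, neg_one_mul, ← latticeTerm_neg_left, latticeTerm_comm]
      push_cast
      ring_nf
  · rintro ⟨a, b⟩
    rcases Int.even_or_odd' (a + b) with ⟨c, h | h⟩
    · exact Or.inl ⟨(c, a - c), by grind⟩
    · exact Or.inr ⟨(a - c - 1, -c), by grind⟩

end Lattice

section Substitution

variable {q : ℝ}

theorem rpow_mem_Ioo_zero_one (hq : q ∈ Set.Ioo (0 : ℝ) 1) {x : ℝ} (hx : 0 < x) :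
    q ^ x ∈ Set.Ioo (0 : ℝ) 1 :=
  ⟨rpow_pos_of_pos hq.1 _, rpow_lt_one hq.1.le hq.2 hx⟩

theorem pow_five_mem_Ioo_zero_one (hq : q ∈ Set.Ioo (0 : ℝ) 1) : q ^ 5 ∈ Set.Ioo (0 : ℝ) 1 :=
  ⟨pow_pos hq.1 _, pow_lt_one₀ hq.1.le hq.2 (by norm_num)⟩

theorem continuousOn_eulerF : ContinuousOn eulerF (Set.Ioo 0 1) := by
  refine ((continuousOn_id.rpow_const (p := -1 / 24) fun x hx => Or.inl hx.1.ne').mul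
    (continuousOn_altTheta (r := 1 / 24) (s := 6) (by norm_num) (by norm_num) (-1))).congr
    fun q hq => ?_
  rw [eulerF_eq_tsum hq.1 hq.2, Pi.mul_apply, altTheta, ← tsum_mul_left]
  refine tsum_congr fun n => ?_
  rw [mul_left_comm, id, ← rpow_add hq.1]
  congr 2
  ring

theorem altTheta_neg_three (hq : 0 < q) :
    altTheta (1 / 40) 10 (-3) q = q ^ ((9 : ℝ) / 40) * jacobiSeries (q ^ 5) (1 / 5) := by
  rw [altTheta, jacobiSeries, ← tsum_mul_left]
  refine tsum_congr fun n => ?_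
  rw [pow_rpow_eq hq, mul_left_comm, ← rpow_add hq]
  congr 2
  push_cast
  ring

theorem altTheta_neg_one (hq : 0 < q) :
    altTheta (1 / 40) 10 (-1) q = q ^ ((1 : ℝ) / 40) * jacobiSeries (q ^ 5) (2 / 5) := by
  rw [altTheta, jacobiSeries, ← tsum_mul_left]
  refine tsum_congr fun n => ?_
  rw [pow_rpow_eq hq, mul_left_comm, ← rpow_add hq]
  congr 2
  push_cast
  ring

theorem jacobiSeries_fifths_pos (hq : q ∈ Set.Ioo (0 : ℝ) 1) :
    0 < jacobiSeries (q ^ 5) (1 / 5) ∧ 0 < jacobiSeries (q ^ 5) (2 / 5) := by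
  have hQ := pow_five_mem_Ioo_zero_one hq
  have h1 := jacobiSeries_nonneg hQ.1 hQ.2 (α := 1 / 5) (by norm_num) (by norm_num)
  have h2 := jacobiSeries_nonneg hQ.1 hQ.2 (α := 2 / 5) (by norm_num) (by norm_num)
  have h := jacobiSeries_mul_jacobiSeries hq.1 hq.2
  have h0 : jacobiSeries (q ^ 5) (1 / 5) * jacobiSeries (q ^ 5) (2 / 5) ≠ 0 := by
    rw [h]
    exact (mul_pos (eulerF_pos hq.1 hq.2) (eulerF_pos hQ.1 hQ.2)).ne'
  exact ⟨h1.lt_of_ne' (left_ne_zero_of_mul h0), h2.lt_of_ne' (right_ne_zero_of_mul h0)⟩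

/-- The reciprocal of the Rogers–Ramanujan continued fraction, as a quotient of theta series. -/
noncomputable def thetaRatio (q : ℝ) : ℝ :=
  altTheta (1 / 40) 10 (-1) q / altTheta (1 / 40) 10 (-3) q

theorem thetaRatio_eq (hq : q ∈ Set.Ioo (0 : ℝ) 1) :
    thetaRatio q = jacobiSeries (q ^ 5) (2 / 5) /
      (q ^ ((1 : ℝ) / 5) * jacobiSeries (q ^ 5) (1 / 5)) := by
  have h : q ^ ((9 : ℝ) / 40) = q ^ ((1 : ℝ) / 40) * q ^ ((1 : ℝ) / 5) := by
    rw [← rpow_add hq.1]; norm_num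
  have := (rpow_pos_of_pos hq.1 ((1 : ℝ) / 40)).ne'
  rw [thetaRatio, altTheta_neg_three hq.1, altTheta_neg_one hq.1, h, mul_assoc,
    mul_div_mul_left _ _ this]

theorem thetaRatio_pos (hq : q ∈ Set.Ioo (0 : ℝ) 1) : 0 < thetaRatio q := by
  rw [thetaRatio_eq hq]
  exact div_pos (jacobiSeries_fifths_pos hq).2
    (mul_pos (rpow_pos_of_pos hq.1 _) (jacobiSeries_fifths_pos hq).1)

/-- Ramanujan's identity relating Euler products to the Rogers–Ramanujan continued fraction. -/
theorem yF_eq_thetaRatio (hq : q ∈ Set.Ioo (0 : ℝ) 1) :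
    yF q = thetaRatio q - 1 - (thetaRatio q)⁻¹ := by
  have hQ := pow_five_mem_Ioo_zero_one hq
  obtain ⟨h1, h2⟩ := jacobiSeries_fifths_pos hq
  have hE := eulerF_pos hQ.1 hQ.2
  have hp := rpow_pos_of_pos hq.1 ((1 : ℝ) / 5)
  have t1 := eq_div_of_mul_eq h1.ne' (quintupleSeries_mul_jacobiSeries hQ.1 hQ.2 (1 / 5))
  have t2 := eq_div_of_mul_eq h2.ne' (quintupleSeries_mul_jacobiSeries hQ.1 hQ.2 (2 / 5))
  rw [show (2 : ℝ) * (1 / 5) = 2 / 5 by norm_num] at t1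
  rw [show (2 : ℝ) * (2 / 5) = 1 - 1 / 5 by norm_num, jacobiSeries_one_sub] at t2
  rw [yF, eulerF_rpow_one_fifth hq.1 hq.2, t1, t2, thetaRatio_eq hq]
  field_simp

theorem hasDerivAt_thetaRatio (hq : q ∈ Set.Ioo (0 : ℝ) 1) :
    HasDerivAt thetaRatio (-(1 / 5) * thetaRatio q * (eulerF q ^ 5 / (q * eulerF (q ^ 5)))) q := by
  have hQ := pow_five_mem_Ioo_zero_one hq
  have hq0 := hq.1
  obtain ⟨h1, h2⟩ := jacobiSeries_fifths_pos hq
  have hE := eulerF_pos hQ.1 hQ.2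
  have hE1 := eulerF_pos hq.1 hq.2
  have h3 : 0 < altTheta (1 / 40) 10 (-3) q := by
    rw [altTheta_neg_three hq.1]
    exact mul_pos (rpow_pos_of_pos hq.1 _) h1
  have hprod : altTheta (1 / 40) 10 (-3) q * altTheta (1 / 40) 10 (-1) q =
      q ^ ((1 : ℝ) / 4) * (eulerF q * eulerF (q ^ 5)) := by
    rw [altTheta_neg_three hq.1, altTheta_neg_one hq.1, mul_mul_mul_comm, ← rpow_add hq.1,
      jacobiSeries_mul_jacobiSeries hq.1 hq.2]
    norm_num
  have hW := altThetaD_mul_sub hq.1 hq.2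
  have hd (t : ℝ) := hasDerivAt_altTheta hq.1 hq.2 (r := 1 / 40) (s := 10) (by norm_num)
    (by norm_num) t
  refine ((hd (-1)).div (hd (-3)) h3.ne').congr_deriv ?_
  rw [thetaRatio]
  generalize altTheta (1 / 40) 10 (-3) q = A at *
  generalize altTheta (1 / 40) 10 (-1) q = B at *
  have hBA : B / A = A * B / A ^ 2 := by field_simp
  have hnum (x y : ℝ) : (x / q * A - B * (y / q)) / A ^ 2 = -(y * B - A * x) / (q * A ^ 2) := by
    field_simp
    ring
  rw [hBA, hprod, hnum, hW]
  field_simp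

theorem sqrt_yF (hq : q ∈ Set.Ioo (0 : ℝ) 1) :
    √(5 + 2 * yF q + yF q ^ 2) = thetaRatio q + (thetaRatio q)⁻¹ := by
  have hu := thetaRatio_pos hq
  rw [sqrt_eq_iff_mul_self_eq_of_pos (by positivity), yF_eq_thetaRatio hq]
  field_simp
  ring

theorem hasDerivAt_yF (hq : q ∈ Set.Ioo (0 : ℝ) 1) :
    HasDerivAt yF (-(1 / 5) * √(5 + 2 * yF q + yF q ^ 2) *
      (eulerF q ^ 5 / (q * eulerF (q ^ 5)))) q := by
  have hu := thetaRatio_pos hq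
  have h := hasDerivAt_thetaRatio hq
  refine (((h.sub_const 1).sub (h.inv hu.ne')).congr_of_eventuallyEq ?_).congr_deriv ?_
  · filter_upwards [isOpen_Ioo.mem_nhds hq] with x hx using yF_eq_thetaRatio hx
  · rw [sqrt_yF hq]
    field_simp
    ring

theorem yF_pos (hq : q ∈ Set.Ioo (0 : ℝ) 1) : 0 < yF q := by
  have hp := rpow_mem_Ioo_zero_one hq (x := 1 / 5) (by norm_num)
  have hQ := pow_five_mem_Ioo_zero_one hq
  exact div_pos (eulerF_pos hp.1 hp.2) (mul_pos hp.1 (eulerF_pos hQ.1 hQ.2))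

end Substitution

theorem integral_G_y (G : ℝ → ℝ) (hG : ContinuousOn G (Set.Ioi 0))
    (a b : ℝ) (ha : 0 < a) (hab : a ≤ b) (hb : b < 1) :
    ∫ q in a..b,
        G (eulerF (q ^ ((1 : ℝ) / 5)) / (q ^ ((1 : ℝ) / 5) * eulerF (q ^ 5))) *
          q ^ (-(4 : ℝ) / 5) * eulerF q ^ 5 / eulerF (q ^ ((1 : ℝ) / 5)) =
      -5 * ∫ x in yF a..yF b, G x / (x * Real.sqrt (5 + 2 * x + x ^ 2)) := by
  have hsub : Set.uIcc a b ⊆ Set.Ioo (0 : ℝ) 1 := by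
    rw [Set.uIcc_of_le hab]
    exact Set.Icc_subset_Ioo ha hb
  have hyc : ContinuousOn yF (Set.uIcc a b) := fun q hq =>
    (hasDerivAt_yF (hsub hq)).continuousAt.continuousWithinAt
  have hEc : ContinuousOn eulerF (Set.uIcc a b) := continuousOn_eulerF.mono hsub
  have hE5c : ContinuousOn (fun q => eulerF (q ^ 5)) (Set.uIcc a b) :=
    continuousOn_eulerF.comp (continuousOn_pow 5) fun q hq => pow_five_mem_Ioo_zero_one (hsub hq)
  have hE5 : ∀ q ∈ Set.uIcc a b, 0 < eulerF (q ^ 5) := fun q hq =>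
    let h := pow_five_mem_Ioo_zero_one (hsub hq); eulerF_pos h.1 h.2
  have hpos : ∀ x : ℝ, 0 < 5 + 2 * x + x ^ 2 := fun x => by nlinarith [sq_nonneg (x + 1)]
  rw [← intervalIntegral.integral_comp_mul_deriv'' (f := yF)
    (f' := fun q => -(1 / 5) * √(5 + 2 * yF q + yF q ^ 2) * (eulerF q ^ 5 / (q * eulerF (q ^ 5))))
    hyc, ← intervalIntegral.integral_const_mul]
  · refine intervalIntegral.integral_congr fun q hq => ?_
    have hq01 := hsub hq
    have hp := rpow_mem_Ioo_zero_one hq01 (x := 1 / 5) (by norm_num)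
    have hEp := eulerF_pos hp.1 hp.2
    have hs := sqrt_pos.2 (hpos (yF q))
    have := hE5 q hq
    have := hq01.1
    have hpq : q ^ (-(4 : ℝ) / 5) = q ^ ((1 : ℝ) / 5) / q := by
      rw [← rpow_sub_one hq01.1.ne']; norm_num
    change G (yF q) * _ * _ / _ = _ * (G (yF q) / (yF q * √(5 + 2 * yF q + yF q ^ 2)) * _)
    generalize √(5 + 2 * yF q + yF q ^ 2) = s at *
    generalize G (yF q) = c
    have := hp.1
    rw [hpq, yF]
    field_simp
  · intro q hq
    refine (hasDerivAt_yF (hsub ?_)).hasDerivWithinAt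
    exact Set.Ioo_subset_Icc_self hq
  · refine (continuousOn_const.mul (ContinuousOn.sqrt (by fun_prop))).mul
      ((hEc.pow 5).div (continuousOn_id.mul hE5c) fun q hq => ?_)
    exact (mul_pos (hsub hq).1 (hE5 q hq)).ne'
  · have hy : yF '' Set.uIcc a b ⊆ Set.Ioi 0 := by
      rintro _ ⟨q, hq, rfl⟩
      exact yF_pos (hsub hq)
    refine (hG.mono hy).div (by fun_prop) fun x hx => ?_
    exact (mul_pos (hy hx) (sqrt_pos.2 (hpos x))).ne'
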